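/- The reciprocal of the twin prime constant satisfies 1/C₂ = ∑_{n odd, n ≥ 1} μ(n)²/(n·φ₂(n)), where the sum runs over all odd positive integers and μ is the Möbius function, and the series converges. -/

import Mathlib

/-- The modified totient function `φ₂`. -/
def phi2 (n : ℕ) : ℕ :=
  ((Finset.Icc 1 n).filter (fun a => Nat.gcd a n = 1 ∧ Nat.gcd (a + 2) n = 1)).card

/-- The twin prime constant `C₂ = ∏_{p odd prime} p(p-2)/(p-1)²`. -/
noncomputable def C2 : ℝ :=
  ∏' p : {p : ℕ // p.Prime ∧ p ≠ 2}, ((p : ℕ) : ℝ) * (((p : ℕ) : ℝ) - 2) / (((p : ℕ) : ℝ) - 1) ^ 2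

open Finset in
lemma phi2_eq_card_zmod (n : ℕ) [NeZero n] :
    phi2 n = Nat.card {x : ZMod n // IsUnit x ∧ IsUnit (x + 2)} := by
  classical
  rw [Nat.card_eq_fintype_card, Fintype.card_subtype, phi2]
  have unit_iff (a : ℕ) : IsUnit (a : ZMod n) ↔ Nat.gcd a n = 1 := ZMod.isUnit_iff_coprime a n
  have mem_iff (a : ℕ) : IsUnit (a : ZMod n) ∧ IsUnit ((a : ZMod n) + 2) ↔
      Nat.gcd a n = 1 ∧ Nat.gcd (a + 2) n = 1 := by
    rw [← unit_iff, ← unit_iff]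
    push_cast
    rfl
  refine card_bij (fun a _ ↦ (a : ZMod n)) ?_ ?_ ?_
  · intro a ha
    simpa using (mem_iff a).2 (mem_filter.1 ha).2
  · intro a ha b hb hab
    have ha := mem_Icc.1 (mem_filter.1 ha).1
    have hb := mem_Icc.1 (mem_filter.1 hb).1
    rw [ZMod.natCast_eq_natCast_iff] at hab
    exact Nat.ModEq.eq_of_abs_lt hab (by rw [abs_lt]; omega)
  · intro x hx
    obtain ⟨a, ha, rfl⟩ : ∃ a ∈ Icc 1 n, (a : ZMod n) = x := by
      by_cases h : x = 0
      · exact ⟨n, by simpa using NeZero.one_le, by simp [h]⟩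
      · refine ⟨x.val, ?_, ZMod.natCast_zmod_val x⟩
        have := (ZMod.val_ne_zero x).2 h
        have := ZMod.val_lt x
        rw [mem_Icc]
        omega
    exact ⟨a, mem_filter.2 ⟨ha, (mem_iff a).1 (mem_filter.1 hx).2⟩, rfl⟩

lemma phi2_one : phi2 1 = 1 := by decide

lemma phi2_mul {m n : ℕ} (hm : m ≠ 0) (hn : n ≠ 0) (h : m.Coprime n) :
    phi2 (m * n) = phi2 m * phi2 n := by
  have : NeZero m := ⟨hm⟩
  have : NeZero n := ⟨hn⟩
  rw [phi2_eq_card_zmod, phi2_eq_card_zmod, phi2_eq_card_zmod, ← Nat.card_prod]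
  let e := ZMod.chineseRemainder h
  refine Nat.card_congr ((e.toEquiv.subtypeEquiv (q := fun y ↦
    (IsUnit y.1 ∧ IsUnit (y.1 + 2)) ∧ (IsUnit y.2 ∧ IsUnit (y.2 + 2))) fun x ↦ ?_).trans
      (Equiv.subtypeProdEquivProd (p := fun a : ZMod m ↦ IsUnit a ∧ IsUnit (a + 2))
        (q := fun b : ZMod n ↦ IsUnit b ∧ IsUnit (b + 2))))
  have h2 : e (x + 2) = e x + 2 := by rw [map_add, map_ofNat]
  rw [← MulEquiv.isUnit_map e (x := x), ← MulEquiv.isUnit_map e (x := x + 2), h2,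
    Prod.isUnit_iff, Prod.isUnit_iff]
  exact and_and_and_comm

open Finset in
lemma phi2_prime {p : ℕ} (hp : p.Prime) (h2 : p ≠ 2) : phi2 p = p - 2 := by
  classical
  have : Fact p.Prime := ⟨hp⟩
  rw [phi2_eq_card_zmod, Nat.card_eq_fintype_card, Fintype.card_subtype]
  have two_ne : (0 : ZMod p) ≠ -2 := by
    intro h
    have : ((2 : ℕ) : ZMod p) = 0 := by
      push_cast
      simpa using h.symm
    rw [ZMod.natCast_eq_zero_iff] at this
    exact h2 ((Nat.prime_dvd_prime_iff_eq hp Nat.prime_two).1 this)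
  have : (univ.filter fun x : ZMod p ↦ IsUnit x ∧ IsUnit (x + 2)) = univ \ {0, -2} := by
    ext x
    simp [isUnit_iff_ne_zero, eq_neg_iff_add_eq_zero]
  rw [this, card_sdiff_of_subset (subset_univ _), card_pair two_ne, card_univ, ZMod.card]

/-- The summand `μ(n)² / (n φ₂(n))`, supported on odd `n`. -/
noncomputable def oddTerm (n : ℕ) : ℝ :=
  if Odd n then (ArithmeticFunction.moebius n : ℝ) ^ 2 / ((n : ℝ) * (phi2 n : ℝ)) else 0

lemma oddTerm_nonneg (n : ℕ) : 0 ≤ oddTerm n := by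
  unfold oddTerm
  split_ifs <;> positivity

lemma oddTerm_zero : oddTerm 0 = 0 := by simp [oddTerm]

lemma oddTerm_one : oddTerm 1 = 1 := by simp [oddTerm, phi2_one]

lemma oddTerm_mul {m n : ℕ} (h : m.Coprime n) : oddTerm (m * n) = oddTerm m * oddTerm n := by
  unfold oddTerm
  by_cases hm : Odd m
  · by_cases hn : Odd n
    · rw [if_pos (hm.mul hn), if_pos hm, if_pos hn, phi2_mul hm.pos.ne' hn.pos.ne' h,
        ArithmeticFunction.isMultiplicative_moebius.map_mul_of_coprime h]
      push_cast
      rw [div_mul_div_comm]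
      ring
    · simp [Nat.odd_mul, hn]
  · simp [Nat.odd_mul, hm]

lemma oddTerm_two : oddTerm 2 = 0 := by
  rw [oddTerm, if_neg (by decide)]

lemma oddTerm_prime {p : ℕ} (hp : p.Prime) (h2 : p ≠ 2) :
    oddTerm p = 1 / ((p : ℝ) * ((p : ℝ) - 2)) := by
  rw [oddTerm, if_pos (hp.odd_of_ne_two h2), ArithmeticFunction.moebius_apply_prime hp,
    phi2_prime hp h2, Nat.cast_sub hp.two_le]
  norm_num

lemma oddTerm_prime_le {p : ℕ} (hp : p.Prime) : oddTerm p ≤ 3 * (1 / (p : ℝ) ^ 2) := by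
  by_cases h2 : p = 2
  · rw [h2, oddTerm_two]
    positivity
  · have h3 : (3 : ℝ) ≤ p := by
      have := hp.two_le
      exact_mod_cast (by omega : 3 ≤ p)
    rw [oddTerm_prime hp h2, mul_one_div, div_le_div_iff₀ (by nlinarith) (by positivity)]
    nlinarith

lemma oddTerm_prime_pow {p : ℕ} (hp : p.Prime) {k : ℕ} (hk : 2 ≤ k) : oddTerm (p ^ k) = 0 := by
  rw [oddTerm, ArithmeticFunction.moebius_apply_prime_pow hp (by omega), if_neg (by omega : k ≠ 1)]
  simp

lemma hasSum_oddTerm_prime_pow {p : ℕ} (hp : p.Prime) :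
    HasSum (fun k ↦ oddTerm (p ^ k)) (1 + oddTerm p) := by
  have : HasSum (fun k ↦ oddTerm (p ^ k)) _ := hasSum_sum_of_ne_finset_zero (s := Finset.range 2)
    fun k hk ↦ oddTerm_prime_pow hp (by rw [Finset.mem_range] at hk; omega)
  simpa [Finset.sum_range_succ, oddTerm_one] using this

lemma summable_oddTerm : Summable oddTerm := by
  have hs : Summable fun n : ℕ ↦ 3 * (1 / (n : ℝ) ^ 2) :=
    (Real.summable_one_div_nat_pow.2 one_lt_two).mul_left 3
  refine summable_of_sum_range_le (c := Real.exp (∑' n : ℕ, 3 * (1 / (n : ℝ) ^ 2)))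
    oddTerm_nonneg fun N ↦ ?_
  have key := (EulerProduct.summable_and_hasSum_smoothNumbers_prod_primesBelow_tsum oddTerm_one
    oddTerm_mul (fun hp ↦ (hasSum_oddTerm_prime_pow hp).summable.norm) N).2
  have hind : HasSum ((Nat.smoothNumbers N).indicator oddTerm)
      (∏ p ∈ N.primesBelow, ∑' k, oddTerm (p ^ k)) := hasSum_subtype_iff_indicator.1 key
  calc ∑ n ∈ Finset.range N, oddTerm n
      = ∑ n ∈ Finset.range N, (Nat.smoothNumbers N).indicator oddTerm n := by
        refine Finset.sum_congr rfl fun n hn ↦ ?_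
        rcases eq_or_ne n 0 with rfl | h0
        · simp [Set.indicator, oddTerm_zero]
        · rw [Set.indicator_of_mem (Nat.mem_smoothNumbers_of_lt (Nat.pos_of_ne_zero h0)
            (Finset.mem_range.1 hn))]
    _ ≤ ∏ p ∈ N.primesBelow, ∑' k, oddTerm (p ^ k) :=
        sum_le_hasSum _ (fun n _ ↦ Set.indicator_nonneg (fun n _ ↦ oddTerm_nonneg n) n) hind
    _ = ∏ p ∈ N.primesBelow, (1 + oddTerm p) := Finset.prod_congr rfl fun p hp ↦
        (hasSum_oddTerm_prime_pow (Nat.prime_of_mem_primesBelow hp)).tsum_eq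
    _ ≤ Real.exp (∑ p ∈ N.primesBelow, oddTerm p) :=
        Real.prod_one_add_le_exp_sum _ fun p ↦ oddTerm_nonneg p
    _ ≤ Real.exp (∑' n : ℕ, 3 * (1 / (n : ℝ) ^ 2)) := by
        refine Real.exp_le_exp.2 (le_trans (Finset.sum_le_sum fun p hp ↦
          oddTerm_prime_le (Nat.prime_of_mem_primesBelow hp)) ?_)
        exact hs.sum_le_tsum _ fun n _ ↦ by positivity

lemma hasProd_one_add_oddTerm :
    HasProd (fun p : {p : ℕ // p.Prime ∧ p ≠ 2} ↦ 1 + oddTerm p) (∑' n, oddTerm n) := by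
  have h := EulerProduct.eulerProduct_hasProd_mulIndicator oddTerm_one oddTerm_mul
    summable_oddTerm.norm oddTerm_zero
  change HasProd ((fun p ↦ 1 + oddTerm p) ∘
    (Subtype.val : ({p | p.Prime ∧ p ≠ 2} : Set ℕ) → ℕ)) _
  rw [hasProd_subtype_iff_mulIndicator]
  suffices Set.mulIndicator {p | Nat.Prime p} (fun p ↦ ∑' k, oddTerm (p ^ k)) =
      Set.mulIndicator {p | p.Prime ∧ p ≠ 2} (fun p ↦ 1 + oddTerm p) by
    rw [this] at h
    exact h
  funext p
  by_cases hp : p.Prime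
  · rw [Set.mulIndicator_of_mem (s := {p | Nat.Prime p}) hp, (hasSum_oddTerm_prime_pow hp).tsum_eq]
    by_cases h2 : p = 2
    · simp [h2, oddTerm_two]
    · rw [Set.mulIndicator_of_mem (s := {p | p.Prime ∧ p ≠ 2}) ⟨hp, h2⟩]
  · simp [hp]

lemma tsum_oddTerm_eq_inv_C2 : ∑' n, oddTerm n = 1 / C2 := by
  have hpos : 0 < ∑' n, oddTerm n :=
    summable_oddTerm.tsum_pos oddTerm_nonneg 1 (by rw [oddTerm_one]; exact one_pos)
  have hC2 : C2 = (∑' n, oddTerm n)⁻¹ := by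
    rw [← (hasProd_one_add_oddTerm.inv₀ hpos.ne').tprod_eq, C2]
    refine tprod_congr fun ⟨p, hp, h2⟩ ↦ ?_
    have h3 : (3 : ℝ) ≤ p := by
      have := hp.two_le
      exact_mod_cast (by omega : 3 ≤ p)
    have : (p : ℝ) - 2 ≠ 0 := by linarith
    have : (p : ℝ) - 1 ≠ 0 := by linarith
    have : (p : ℝ) ≠ 0 := by linarith
    have hadd : 1 + oddTerm p = ((p : ℝ) - 1) ^ 2 / (p * (p - 2)) := by
      rw [oddTerm_prime hp h2]
      field_simp
      ring
    rw [hadd, inv_div]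
  rw [hC2, one_div, inv_inv]


/-- `1/C₂ = ∑_{n odd} μ(n)²/(n·φ₂(n))`, the series being convergent. -/
theorem twin_prime_constant_reciprocal_series :
    Summable (fun n : ℕ =>
      if Odd n then (ArithmeticFunction.moebius n : ℝ) ^ 2 / ((n : ℝ) * (phi2 n : ℝ)) else 0) ∧
    ∑' n : ℕ,
        (if Odd n then (ArithmeticFunction.moebius n : ℝ) ^ 2 / ((n : ℝ) * (phi2 n : ℝ)) else 0)
      = 1 / C2 :=
  ⟨summable_oddTerm, tsum_oddTerm_eq_inv_C2⟩
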